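/- Let g be even, let Γ̄ be the tropical hyperelliptic curve of genus g, Γ its bounded part, and D* = (g/2)(V_0 + V_0′). For any points P_1, …, P_{g/2} on Γ, with conjugates P_1′, …, P_{g/2}′, there exists a rational function h on Γ with (h) = P_1 + ⋯ + P_{g/2} + P_1′ + ⋯ + P_{g/2}′ − D*; equivalently (P_1⋯P_{g/2}P_1′⋯P_{g/2}′) = φ̄(P_1 + ⋯ + P_{g/2} + P_1′ + ⋯ + P_{g/2}′) = 0 in J(Γ). -/

import Mathlib

open scoped BigOperators

namespace TropicalHyperelliptic

/-! ## The tropical hyperelliptic curve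

For a genus `g ≥ 1` and parameters `c₋₁, c₀, …, c_{g+1}` (encoded as a function
`c : ℤ → ℝ`; only the values `c (-1), …, c (g+1)` matter), the tropical
polynomial `F̃(X,Y) = max(2Y, Y + P̃(X), c₋₁)` with
`P̃(X) = max_{0 ≤ i ≤ g+1} (c_i + iX)` defines the tropical hyperelliptic curve
`Γ̄` as the locus of points of `ℝ²` where `F̃` fails to be differentiable. -/

/-- The tropical polynomial `P̃(X) = max_{0 ≤ i ≤ g+1} (c_i + i X)`. -/
noncomputable def Ptilde (g : ℕ) (c : ℤ → ℝ) (X : ℝ) : ℝ :=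
  (Finset.range (g + 2)).sup' (Finset.nonempty_range_iff.mpr (by omega))
    fun i => c (i : ℤ) + (i : ℝ) * X

/-- The tropical polynomial `F̃(X,Y) = max(2Y, Y + P̃(X), c₋₁)`. -/
noncomputable def Ftilde (g : ℕ) (c : ℤ → ℝ) (P : ℝ × ℝ) : ℝ :=
  max (2 * P.2) (max (P.2 + Ptilde g c P.1) (c (-1)))

/-- The tropical hyperelliptic curve `Γ̄` of genus `g`: the set of points of
`ℝ²` at which `F̃` is not differentiable. -/
def curveBar (g : ℕ) (c : ℤ → ℝ) : Set (ℝ × ℝ) :=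
  {P | ¬ DifferentiableAt ℝ (Ftilde g c) P}

/-- The hypotheses on the parameters: `c_{g+1} = c_g = 0`, `c₋₁ < 2c₀`,
`cᵢ + c_{i+2} < 2c_{i+1}` for `0 ≤ i ≤ g − 2`, and `c_{g−1} < 2c_g = 0`.
Under these assumptions `Γ̄` is a smooth tropical curve of genus `g`. -/
def Hyp (g : ℕ) (c : ℤ → ℝ) : Prop :=
  c ((g : ℤ) + 1) = 0 ∧ c (g : ℤ) = 0 ∧ c (-1) < 2 * c 0 ∧
  (∀ i : ℕ, (i : ℤ) ≤ (g : ℤ) - 2 → c i + c ((i : ℤ) + 2) < 2 * c ((i : ℤ) + 1)) ∧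
  c ((g : ℤ) - 1) < 0

/-- The vertices `V_i` (`0 ≤ i ≤ g`) of `Γ̄` lying above the line
`Y = c₋₁/2`:  `V_0 = (0,0)` and
`V_i = (c_{g−i} − c_{g−i+1}, (g−i+1)c_{g−i} − (g−i)c_{g−i+1})`.
(The formula below also gives `V_0 = (0,0)` for `i = 0`, since
`c_g = c_{g+1} = 0`.) -/
noncomputable def V (g : ℕ) (c : ℤ → ℝ) (i : ℕ) : ℝ × ℝ :=
  (c ((g : ℤ) - i) - c ((g : ℤ) - i + 1),
   (((g : ℤ) - i + 1 : ℤ) : ℝ) * c ((g : ℤ) - i)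
     - (((g : ℤ) - i : ℤ) : ℝ) * c ((g : ℤ) - i + 1))

/-- The conjugate `P′` of a point `P`: the reflection with respect to the line
`Y = c₋₁/2`. -/
def conj (c : ℤ → ℝ) (P : ℝ × ℝ) : ℝ × ℝ := (P.1, c (-1) - P.2)

/-- The metric graph `Γ` obtained from `Γ̄` by removing all unbounded edges:
the part of `Γ̄` lying in the vertical strip `x(V_g) ≤ X ≤ x(V_0) = 0`,
where `x(V_g) = c_0 − c_1`. -/
def Gam (g : ℕ) (c : ℤ → ℝ) : Set (ℝ × ℝ) :=
  {P ∈ curveBar g c | c 0 - c 1 ≤ P.1 ∧ P.1 ≤ 0}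

/-! ## Rational functions, orders, and divisors -/

/-- The image in `ℝ²` of an integer vector. -/
def vr (v : ℤ × ℤ) : ℝ × ℝ := ((v.1 : ℝ), (v.2 : ℝ))

/-- The primitive integer directions along which one can leave the point `P`
inside the set `S` (the outgoing directions of the segments of `S` emanating
from `P`). -/
def localDirs (S : Set (ℝ × ℝ)) (P : ℝ × ℝ) : Set (ℤ × ℤ) :=
  {v | IsCoprime v.1 v.2 ∧ ∃ ε > (0 : ℝ), ∀ t : ℝ, 0 < t → t < ε → P + t • vr v ∈ S}

/-- `f` has (integer) outgoing slope `s` at `P` in the direction `v` (slopes are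
measured with respect to the lattice length). -/
def HasSlope (S : Set (ℝ × ℝ)) (f : ℝ × ℝ → ℝ) (P : ℝ × ℝ) (v : ℤ × ℤ) (s : ℤ) : Prop :=
  ∃ ε > (0 : ℝ), ∀ t : ℝ, 0 ≤ t → t < ε → P + t • vr v ∈ S →
    f (P + t • vr v) = f P + (s : ℝ) * t

/-- A rational function on (the tropical curve) `S ⊆ ℝ²`: a continuous function
whose restriction to every edge is piecewise linear with integer slopes,
i.e. which has an integer outgoing slope at every point of `S` in every
outgoing direction. -/
structure IsRationalFn (S : Set (ℝ × ℝ)) (f : ℝ × ℝ → ℝ) : Prop where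
  cont : ContinuousOn f S
  slope_int : ∀ P ∈ S, ∀ v ∈ localDirs S P, ∃ s : ℤ, HasSlope S f P v s

/-- The outgoing slope of `f` at `P` in the direction `v` (defaulting to `0`
when no integer slope exists). -/
noncomputable def slope (S : Set (ℝ × ℝ)) (f : ℝ × ℝ → ℝ) (P : ℝ × ℝ) (v : ℤ × ℤ) : ℤ :=
  open scoped Classical in
  if h : ∃ s : ℤ, HasSlope S f P v s then h.choose else 0

/-- The order `ord_P f`: the sum of the outgoing slopes of `f` over all segments
of `S` emanating from `P`.  Points with `ord_P f > 0` are the zeros of `f`,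
points with `ord_P f < 0` its poles. -/
noncomputable def ord (S : Set (ℝ × ℝ)) (f : ℝ × ℝ → ℝ) (P : ℝ × ℝ) : ℤ :=
  ∑ᶠ v ∈ localDirs S P, slope S f P v

/-- Divisors: formal `ℤ`-linear combinations of finitely many points of `ℝ²`. -/
abbrev Div := (ℝ × ℝ) →₀ ℤ

/-- The degree of a divisor: the sum of its coefficients. -/
def deg (D : Div) : ℤ := D.sum fun _ n => n

/-- A divisor is effective (`D > 0`) when all its coefficients are nonnegative. -/
def Eff (D : Div) : Prop := ∀ P, 0 ≤ D P

/-- `R(D)`: the set of rational functions `f` on `S` with `(f) + D` effective. -/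
def RSet (S : Set (ℝ × ℝ)) (D : Div) : Set ((ℝ × ℝ) → ℝ) :=
  {f | IsRationalFn S f ∧ ∀ P ∈ S, 0 ≤ ord S f P + D P}

/-- A divisor is principal when it is the divisor `(f) = Σ_P (ord_P f)·P` of a
rational function `f` on `S`. -/
def IsPrincipal (S : Set (ℝ × ℝ)) (D : Div) : Prop :=
  ∃ f : (ℝ × ℝ) → ℝ, IsRationalFn S f ∧ ∀ P, D P = ord S f P

/-- Two divisors are (linearly) equivalent, `D ∼ D′`, when `D′ = D + (f)` for
some rational function `f` on `S`. -/
def LinEquiv (S : Set (ℝ × ℝ)) (D D' : Div) : Prop :=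
  ∃ f : (ℝ × ℝ) → ℝ, IsRationalFn S f ∧ ∀ P, D' P = D P + ord S f P

end TropicalHyperelliptic

/-! ## The cycles `α_i` and the set `𝔇̃_g^+(Γ)` -/

namespace TropicalHyperelliptic

/-- The basis cycle `α_i` (`1 ≤ i ≤ g`) of the fundamental group `π₁(Γ)`:
the cycle of `Γ` through the vertices `V_{i−1}`, `V_i` and their conjugates
`V_{i−1}′`, `V_i′`, i.e. the part of `Γ` in the vertical strip
`x(V_i) ≤ X ≤ x(V_{i−1})`. -/
def alphaCycle (g : ℕ) (c : ℤ → ℝ) (i : ℕ) : Set (ℝ × ℝ) :=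
  {P ∈ Gam g c | (V g c i).1 ≤ P.1 ∧ P.1 ≤ (V g c (i - 1)).1}

/-- The overlap `α_{k,k+1} = (α_k ∩ α_{k+1}) ∖ {endpoints}` (`1 ≤ k ≤ g − 1`):
the open vertical edge of `Γ` joining `V_k` to `V_k′`.  (For non-adjacent
indices the overlaps `α_i ∩ α_j` are empty.) -/
def alphaOpen (g : ℕ) (c : ℤ → ℝ) (k : ℕ) : Set (ℝ × ℝ) :=
  {P ∈ Gam g c | P.1 = (V g c k).1 ∧ P ≠ V g c k ∧ P ≠ conj c (V g c k)}

/-- The subset `𝔇̃_g^+(Γ)` of `𝔇_g^+(Γ)`: effective divisors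
`P_1 + ⋯ + P_g` with `P_i ∈ α_i` for all `i`, such that each overlap `α_{ij}`
contains at most one of the points. -/
def Dtilde (g : ℕ) (c : ℤ → ℝ) : Set Div :=
  {D | ∃ Pt : Fin g → ℝ × ℝ,
    (∀ i : Fin g, Pt i ∈ alphaCycle g c (i + 1)) ∧
    (∀ k : ℕ, 1 ≤ k → k ≤ g - 1 →
      ∀ i j : Fin g, Pt i ∈ alphaOpen g c k → Pt j ∈ alphaOpen g c k → i = j) ∧
    D = ∑ i : Fin g, Finsupp.single (Pt i) (1 : ℤ)}

/-- For even `g`, the base divisor `D* = (g/2)(V_0 + V_0′)`. -/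
noncomputable def DstarEven (g : ℕ) (c : ℤ → ℝ) : Div :=
  ((g / 2 : ℕ) : ℤ) •
    (Finsupp.single (V g c 0) (1 : ℤ) + Finsupp.single (conj c (V g c 0)) (1 : ℤ))

/-- For odd `g`, the base divisor `D* = ((g−1)/2)(V_0 + V_0′) + V_0`. -/
noncomputable def DstarOdd (g : ℕ) (c : ℤ → ℝ) : Div :=
  (((g - 1) / 2 : ℕ) : ℤ) •
    (Finsupp.single (V g c 0) (1 : ℤ) + Finsupp.single (conj c (V g c 0)) (1 : ℤ))
  + Finsupp.single (V g c 0) (1 : ℤ)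

end TropicalHyperelliptic

open TropicalHyperelliptic

namespace TropicalHyperelliptic

/-- Local right-linearity of a finite maximum of affine functions with integer slopes. -/
lemma sup_affine_local (s : Finset ℕ) (hs : s.Nonempty) (α : ℕ → ℝ) (β : ℕ → ℤ) :
    ∃ m : ℤ, ∃ ε > (0 : ℝ), ∀ t : ℝ, 0 ≤ t → t < ε →
      s.sup' hs (fun i => α i + β i * t) = s.sup' hs (fun i => α i + β i * 0) + m * t := by
  induction hs using Finset.Nonempty.cons_induction with
  | singleton a => exact ⟨β a, 1, one_pos, fun t _ _ => by simp⟩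
  | cons a s ha hs ih =>
    obtain ⟨m, ε, hε, h⟩ := ih
    simp only [Finset.sup'_cons hs]
    set q0 := s.sup' hs (fun i => α i + β i * (0 : ℝ)) with hq0
    have key : ∀ x y : ℝ, ∀ k l : ℤ, ∃ n : ℤ, ∃ δ > (0 : ℝ), ∀ t : ℝ, 0 ≤ t → t < δ →
        max (x + k * t) (y + l * t) = max x y + n * t := by
      intro x y k l
      have lt : ∀ x y : ℝ, ∀ k l : ℤ, x < y → ∃ δ > (0 : ℝ), ∀ t : ℝ, 0 ≤ t → t < δ →
          x + k * t < y + l * t := by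
        intro x y k l hxy
        have hpos : (0 : ℝ) < |(k : ℝ) - l| + 1 := by positivity
        refine ⟨(y - x) / (|(k : ℝ) - l| + 1), div_pos (by linarith) hpos, fun t ht0 ht => ?_⟩
        rw [lt_div_iff₀ hpos] at ht
        have := le_abs_self ((k : ℝ) - l)
        nlinarith
      rcases lt_trichotomy x y with hxy | hxy | hxy
      · obtain ⟨δ, hδ, h⟩ := lt x y k l hxy
        refine ⟨l, δ, hδ, fun t h0 h1 => ?_⟩
        rw [max_eq_right (h t h0 h1).le, max_eq_right hxy.le]
      · subst hxy
        rcases le_total k l with hkl | hkl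
        · refine ⟨l, 1, one_pos, fun t h0 h1 => ?_⟩
          have : (k : ℝ) ≤ l := by exact_mod_cast hkl
          rw [max_self, max_eq_right (by nlinarith)]
        · refine ⟨k, 1, one_pos, fun t h0 h1 => ?_⟩
          have : (l : ℝ) ≤ k := by exact_mod_cast hkl
          rw [max_self, max_eq_left (by nlinarith)]
      · obtain ⟨δ, hδ, h⟩ := lt y x l k hxy
        refine ⟨k, δ, hδ, fun t h0 h1 => ?_⟩
        rw [max_eq_left (h t h0 h1).le, max_eq_left hxy.le]
    obtain ⟨n, δ, hδ, hn⟩ := key (α a) q0 (β a) m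
    refine ⟨n, min ε δ, lt_min hε hδ, fun t h0 h1 => ?_⟩
    rw [h t h0 (h1.trans_le (min_le_left _ _))]
    have := hn t h0 (h1.trans_le (min_le_right _ _))
    simpa using this

lemma Ptilde_right (g : ℕ) (c : ℤ → ℝ) (X : ℝ) :
    ∃ m : ℤ, ∃ ε > (0 : ℝ), ∀ t : ℝ, 0 ≤ t → t < ε →
      Ptilde g c (X + t) = Ptilde g c X + m * t := by
  obtain ⟨m, ε, hε, h⟩ := sup_affine_local (Finset.range (g + 2))
    (Finset.nonempty_range_iff.mpr (by omega)) (fun i => c i + i * X) (fun i => i)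
  refine ⟨m, ε, hε, fun t h0 h1 => ?_⟩
  have := h t h0 h1
  unfold Ptilde
  simp only [mul_zero, add_zero, Int.cast_natCast] at this
  rw [← this]
  congr 1; funext i; ring

lemma Ptilde_left (g : ℕ) (c : ℤ → ℝ) (X : ℝ) :
    ∃ m : ℤ, ∃ ε > (0 : ℝ), ∀ t : ℝ, 0 ≤ t → t < ε →
      Ptilde g c (X - t) = Ptilde g c X + m * t := by
  obtain ⟨m, ε, hε, h⟩ := sup_affine_local (Finset.range (g + 2))
    (Finset.nonempty_range_iff.mpr (by omega)) (fun i => c i + i * X) (fun i => -(i : ℤ))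
  refine ⟨m, ε, hε, fun t h0 h1 => ?_⟩
  have := h t h0 h1
  unfold Ptilde
  simp only [mul_zero, add_zero, Int.cast_natCast, Int.cast_neg] at this
  rw [← this]
  congr 1; funext i; ring

lemma Ptilde_cont (g : ℕ) (c : ℤ → ℝ) : Continuous (Ptilde g c) := by
  unfold Ptilde
  apply Continuous.finset_sup'_apply
  intro i _
  fun_prop

/-- The kinks of `Ptilde`. -/
def Kink (g : ℕ) (c : ℤ → ℝ) (X : ℝ) : Prop := ¬ DifferentiableAt ℝ (Ptilde g c) X

/-- Punctured neighbourhoods contain no kinks. -/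
lemma not_kink_near (g : ℕ) (c : ℤ → ℝ) (X : ℝ) :
    ∃ ε > (0 : ℝ), ∀ Z : ℝ, |Z - X| < ε → Z ≠ X → ¬ Kink g c Z := by
  obtain ⟨m, ε, hε, h⟩ := Ptilde_right g c X
  obtain ⟨m', ε', hε', h'⟩ := Ptilde_left g c X
  refine ⟨min ε ε', lt_min hε hε', fun Z hZ hne => ?_⟩
  have hZ1 := hZ.trans_le (min_le_left _ _)
  have hZ2 := hZ.trans_le (min_le_right _ _)
  rw [abs_lt] at hZ1 hZ2
  unfold Kink
  rw [not_not]
  rcases lt_or_gt_of_ne hne with hlt | hgt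
  · have : Ptilde g c =ᶠ[nhds Z] fun W => Ptilde g c X + m' * (X - W) := by
      filter_upwards [Ioo_mem_nhds (show X - ε' < Z by linarith) hlt] with W hW
      have := h' (X - W) (by linarith [hW.2]) (by linarith [hW.1])
      rwa [sub_sub_cancel] at this
    exact this.differentiableAt_iff.mpr (by fun_prop)
  · have : Ptilde g c =ᶠ[nhds Z] fun W => Ptilde g c X + m * (W - X) := by
      filter_upwards [Ioo_mem_nhds hgt (show Z < X + ε by linarith)] with W hW
      have := h (W - X) (by linarith [hW.1]) (by linarith [hW.2])
      rwa [add_sub_cancel] at this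
    exact this.differentiableAt_iff.mpr (by fun_prop)

lemma Ptilde_gt (g : ℕ) (c : ℤ → ℝ) (hc : Hyp g c) (X : ℝ) : c (-1) < 2 * Ptilde g c X := by
  have h1 : c 0 ≤ Ptilde g c X := by
    have := Finset.le_sup' (s := Finset.range (g + 2)) (fun i : ℕ => c (i : ℤ) + (i : ℝ) * X)
      (show 0 ∈ Finset.range (g + 2) by simp)
    unfold Ptilde
    refine le_trans ?_ this
    simp
  have := hc.2.2.1
  linarith

lemma Ptilde_zero (g : ℕ) (c : ℤ → ℝ) (hg2 : 2 ≤ g) (hc : Hyp g c) : Ptilde g c 0 = 0 := by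
  obtain ⟨h1, h2, h3, h4, h5⟩ := hc
  have hd : ∀ k : ℕ, k + 1 ≤ g → c ((g : ℤ) - k - 1) < c ((g : ℤ) - k) ∧ c ((g : ℤ) - k) ≤ 0 := by
    intro k
    induction k with
    | zero => intro _; simp [h2, h5]
    | succ k ih =>
      intro hk
      have ih := ih (by omega)
      have := h4 (g - k - 2) (by omega)
      have e1 : ((g - k - 2 : ℕ) : ℤ) = (g : ℤ) - k - 2 := by omega
      rw [e1] at this
      have e2 : (g : ℤ) - k - 2 + 2 = g - k := by ring
      have e3 : (g : ℤ) - k - 2 + 1 = g - k - 1 := by ring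
      rw [e2, e3] at this
      push_cast
      have e4 : (g : ℤ) - (k + 1) - 1 = g - k - 2 := by ring
      have e5 : (g : ℤ) - (k + 1) = g - k - 1 := by ring
      rw [e4, e5]
      constructor <;> linarith
  apply le_antisymm
  · unfold Ptilde
    apply Finset.sup'_le
    intro i hi
    rw [Finset.mem_range] at hi
    simp only [mul_zero, add_zero]
    rcases Nat.lt_or_ge i g with hig | hig
    · have := hd (g - i - 1) (by omega)
      have e1 : (g : ℤ) - ((g - i - 1 : ℕ) : ℤ) - 1 = i := by omega
      rw [e1] at this
      linarith
    · have : i = g ∨ i = g + 1 := by omega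
      rcases this with rfl | rfl
      · exact h2.le
      · push_cast; exact h1.le
  · have := Finset.le_sup' (s := Finset.range (g + 2)) (fun i : ℕ => c (i : ℤ) + (i : ℝ) * 0)
      (show g ∈ Finset.range (g + 2) by simp)
    unfold Ptilde
    refine le_trans ?_ this
    simp [h2]

/-- Description of the curve. -/
lemma mem_curveBar (g : ℕ) (c : ℤ → ℝ) (hc : Hyp g c) (X Y : ℝ) :
    (X, Y) ∈ curveBar g c ↔ Y = Ptilde g c X ∨ Y = c (-1) - Ptilde g c X ∨
      (c (-1) - Ptilde g c X < Y ∧ Y < Ptilde g c X ∧ Kink g c X) := by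
  have hP := Ptilde_gt g c hc X
  have hcont := Ptilde_cont g c
  have hc1 : Continuous fun Q : ℝ × ℝ => Ptilde g c Q.1 := hcont.comp continuous_fst
  have hline : ∀ p, DifferentiableAt ℝ (Ftilde g c) (X, p) →
      DifferentiableAt ℝ (fun t => Ftilde g c (X, t)) p := by
    intro p hp
    exact DifferentiableAt.comp (f := fun t : ℝ => (X, t)) p hp (by fun_prop)
  have hnabs : ∀ p : ℝ, ¬ DifferentiableAt ℝ (fun t : ℝ => |t - p|) p := by
    intro p hp
    have hp' : DifferentiableAt ℝ (fun t : ℝ => |t - p|) (0 + p) := by simpa using hp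
    have := DifferentiableAt.comp (f := fun t : ℝ => t + p) 0 hp' (by fun_prop)
    apply not_differentiableAt_abs_zero
    have e : (abs : ℝ → ℝ) = ((fun t => |t - p|) ∘ fun t => t + p) := by funext t; simp
    rw [e]; exact this
  unfold curveBar
  simp only [Set.mem_ofPred_eq]
  rcases lt_trichotomy Y (Ptilde g c X) with h | h | h
  · rcases lt_trichotomy Y (c (-1) - Ptilde g c X) with h' | h' | h'
    · have : Ftilde g c =ᶠ[nhds (X, Y)] fun _ => c (-1) := by
        have o : IsOpen {Q : ℝ × ℝ | Q.2 < c (-1) - Ptilde g c Q.1} :=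
          isOpen_lt continuous_snd (continuous_const.sub hc1)
        filter_upwards [o.mem_nhds (show (X, Y) ∈ _ from h')] with Q hQ
        have := Ptilde_gt g c hc Q.1
        unfold Ftilde
        rw [max_eq_right (a := Q.2 + _) (by linarith), max_eq_right (by linarith)]
      have hd : DifferentiableAt ℝ (Ftilde g c) (X, Y) :=
        this.differentiableAt_iff.mpr (by fun_prop)
      constructor
      · intro h0; exact absurd hd h0
      · rintro (h0 | h0 | h0) <;> linarith
    · refine ⟨fun _ => Or.inr (Or.inl h'), fun _ hd => ?_⟩
      have hd := hline _ hd
      apply hnabs Y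
      have : (fun t : ℝ => |t - Y|) =ᶠ[nhds Y]
          fun t => 2 * Ftilde g c (X, t) - t - Ptilde g c X - c (-1) := by
        filter_upwards [Iio_mem_nhds h] with t ht
        simp only [Set.mem_Iio] at ht
        unfold Ftilde
        simp only
        rw [max_eq_right (a := 2 * t) (le_max_of_le_left (by linarith))]
        rcases le_total t Y with h1 | h1
        · rw [max_eq_right (by linarith), abs_of_nonpos (by linarith)]; linarith
        · rw [max_eq_left (by linarith), abs_of_nonneg (by linarith)]; linarith
      exact this.differentiableAt_iff.mpr (by fun_prop)
    · have : Ftilde g c =ᶠ[nhds (X, Y)] fun Q => Q.2 + Ptilde g c Q.1 := by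
        have o : IsOpen {Q : ℝ × ℝ | c (-1) - Ptilde g c Q.1 < Q.2} :=
          isOpen_lt (continuous_const.sub hc1) continuous_snd
        have o' : IsOpen {Q : ℝ × ℝ | Q.2 < Ptilde g c Q.1} := isOpen_lt continuous_snd hc1
        filter_upwards [o.mem_nhds (show (X, Y) ∈ _ from h'),
          o'.mem_nhds (show (X, Y) ∈ _ from h)] with Q hQ hQ'
        unfold Ftilde
        rw [max_eq_left (a := Q.2 + _) (by linarith), max_eq_right (by linarith)]
      rw [this.differentiableAt_iff]
      constructor
      · intro h0
        refine Or.inr (Or.inr ⟨h', h, fun hd => h0 ?_⟩)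
        have : DifferentiableAt ℝ (fun Q : ℝ × ℝ => Ptilde g c Q.1) (X, Y) :=
          DifferentiableAt.comp (f := fun Q : ℝ × ℝ => Q.1) (X, Y) hd (by fun_prop)
        fun_prop
      · rintro (h0 | h0 | h0) hd
        · linarith
        · linarith
        · apply h0.2.2
          have := DifferentiableAt.comp (f := fun t : ℝ => (t, Y)) X hd (by fun_prop)
          have h2 := this.sub_const Y
          have e : Ptilde g c =
              (fun y => ((fun Q : ℝ × ℝ => Q.2 + Ptilde g c Q.1) ∘ fun t => (t, Y)) y - Y) := by
            funext t; simp
          rw [e]; exact h2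
  · refine ⟨fun _ => Or.inl h, fun _ hd => ?_⟩
    have hd := hline _ hd
    apply hnabs Y
    have : (fun t : ℝ => |t - Y|) =ᶠ[nhds Y]
        fun t => 2 * Ftilde g c (X, t) - 3 * t - Ptilde g c X := by
      filter_upwards [Ioi_mem_nhds (show c (-1) - Ptilde g c X < Y by linarith)] with t ht
      simp only [Set.mem_Ioi] at ht
      unfold Ftilde
      simp only
      rw [max_eq_left (a := t + _) (by linarith)]
      rcases le_total t Y with h1 | h1
      · rw [max_eq_right (by linarith), abs_of_nonpos (by linarith)]; linarith
      · rw [max_eq_left (by linarith), abs_of_nonneg (by linarith)]; linarith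
    exact this.differentiableAt_iff.mpr (by fun_prop)
  · have : Ftilde g c =ᶠ[nhds (X, Y)] fun Q => 2 * Q.2 := by
      have o : IsOpen {Q : ℝ × ℝ | Ptilde g c Q.1 < Q.2} := isOpen_lt hc1 continuous_snd
      filter_upwards [o.mem_nhds (show (X, Y) ∈ _ from h)] with Q hQ
      have := Ptilde_gt g c hc Q.1
      unfold Ftilde
      rw [max_eq_left (max_le (by linarith) (by linarith))]
    have hd : DifferentiableAt ℝ (Ftilde g c) (X, Y) :=
      this.differentiableAt_iff.mpr (by fun_prop)
    constructor
    · intro h0; exact absurd hd h0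
    · rintro (h0 | h0 | h0) <;> linarith

lemma mem_Gam (g : ℕ) (c : ℤ → ℝ) (hc : Hyp g c) (X Y : ℝ) :
    (X, Y) ∈ Gam g c ↔ (Y = Ptilde g c X ∨ Y = c (-1) - Ptilde g c X ∨
      (c (-1) - Ptilde g c X < Y ∧ Y < Ptilde g c X ∧ Kink g c X)) ∧
      c 0 - c 1 ≤ X ∧ X ≤ 0 := by
  rw [← mem_curveBar g c hc]; rfl

open Filter Topology in
lemma ev_iff (p : ℝ → Prop) :
    (∃ ε > (0 : ℝ), ∀ t : ℝ, 0 < t → t < ε → p t) ↔ ∀ᶠ t in 𝓝[>] (0 : ℝ), p t := by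
  constructor
  · rintro ⟨ε, hε, h⟩
    filter_upwards [Ioo_mem_nhdsGT hε] with t ht
    exact h t ht.1 ht.2
  · intro h
    obtain ⟨u, hu, hs⟩ := (mem_nhdsGT_iff_exists_Ioo_subset).mp h
    exact ⟨u, hu, fun t h0 h1 => hs ⟨h0, h1⟩⟩

open Filter Topology in
lemma ev_lin_lt {x y : ℝ} (k l : ℝ) (h : x < y) :
    ∀ᶠ t in 𝓝[>] (0 : ℝ), x + t * k < y + t * l := by
  have : ∀ᶠ t in 𝓝 (0 : ℝ), x + t * k < y + t * l :=
    (ContinuousAt.eventually_lt (by fun_prop) (by fun_prop) (by simpa using h))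
  exact this.filter_mono nhdsWithin_le_nhds

open Filter Topology in
lemma ev_lin_ne {x y : ℝ} (k l : ℝ) (h : x ≠ y) :
    ∀ᶠ t in 𝓝[>] (0 : ℝ), x + t * k ≠ y + t * l := by
  rcases lt_or_gt_of_ne h with h | h
  · filter_upwards [ev_lin_lt k l h] with t ht using ht.ne
  · filter_upwards [ev_lin_lt l k h] with t ht using ht.ne'

lemma add_vr (X Y t : ℝ) (v : ℤ × ℤ) :
    ((X, Y) : ℝ × ℝ) + t • vr v = (X + t * v.1, Y + t * v.2) := by
  simp [vr]

open Filter Topology in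
lemma localDirs_iff (S : Set (ℝ × ℝ)) (X Y : ℝ) (v : ℤ × ℤ) :
    v ∈ localDirs S (X, Y) ↔ IsCoprime v.1 v.2 ∧
      ∀ᶠ t in 𝓝[>] (0 : ℝ), (X + t * v.1, Y + t * v.2) ∈ S := by
  rw [← ev_iff]
  simp only [← add_vr]
  rfl

open Filter Topology in
lemma ev_not_kink (g : ℕ) (c : ℤ → ℝ) (X : ℝ) {k : ℝ} (hk : k ≠ 0) :
    ∀ᶠ t in 𝓝[>] (0 : ℝ), ¬ Kink g c (X + t * k) := by
  obtain ⟨ε, hε, h⟩ := not_kink_near g c X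
  have hk' : 0 < |k| := abs_pos.mpr hk
  filter_upwards [Ioo_mem_nhdsGT (div_pos hε hk')] with t ht
  apply h
  · rw [add_sub_cancel_left, abs_mul, abs_of_pos ht.1]
    exact (lt_div_iff₀ hk').mp ht.2
  · have := mul_ne_zero ht.1.ne' hk
    intro h0; apply this; linarith

open Filter Topology in
lemma dirs_nonvert (g : ℕ) (c : ℤ → ℝ) (hc : Hyp g c) (X Y : ℝ) (v : ℤ × ℤ) (n : ℝ)
    (hv1 : v.1 ≠ 0)
    (hv : ∀ᶠ t in 𝓝[>] (0 : ℝ), (X + t * v.1, Y + t * v.2) ∈ Gam g c)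
    (hn : ∀ᶠ t in 𝓝[>] (0 : ℝ), Ptilde g c (X + t * v.1) = Ptilde g c X + t * n) :
    (Y = Ptilde g c X ∧ (v.2 : ℝ) = n) ∨ (Y = c (-1) - Ptilde g c X ∧ (v.2 : ℝ) = -n) := by
  have hP := Ptilde_gt g c hc X
  have hk := ev_not_kink g c X (k := (v.1 : ℝ)) (by exact_mod_cast hv1)
  have hpos : ∀ᶠ t in 𝓝[>] (0 : ℝ), 0 < t := self_mem_nhdsWithin
  have h : ∀ᶠ t in 𝓝[>] (0 : ℝ), 0 < t ∧ (Y + t * v.2 = Ptilde g c X + t * n ∨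
      Y + t * v.2 = (c (-1) - Ptilde g c X) + t * (-n)) := by
    filter_upwards [hv, hk, hn, hpos] with t h1 h2 h3 h4
    rw [mem_Gam g c hc, h3] at h1
    refine ⟨h4, ?_⟩
    rcases h1.1 with h | h | h
    · exact Or.inl h
    · right; linarith
    · exact absurd h.2.2 h2
  by_cases e1 : Y = Ptilde g c X
  · left
    refine ⟨e1, ?_⟩
    have := ev_lin_ne (v.2 : ℝ) (-n) (show Y ≠ c (-1) - Ptilde g c X by
      intro h0; linarith)
    obtain ⟨t, ⟨ht, h1⟩, h2⟩ := (h.and this).exists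
    rcases h1 with h1 | h1
    · exact mul_left_cancel₀ ht.ne' (by linarith)
    · exact absurd h1 h2
  · by_cases e2 : Y = c (-1) - Ptilde g c X
    · right
      refine ⟨e2, ?_⟩
      have := ev_lin_ne (v.2 : ℝ) n e1
      obtain ⟨t, ⟨ht, h1⟩, h2⟩ := (h.and this).exists
      rcases h1 with h1 | h1
      · exact absurd h1 h2
      · exact mul_left_cancel₀ ht.ne' (by linarith)
    · obtain ⟨t, ⟨⟨ht, h1⟩, h2⟩, h3⟩ :=
        ((h.and (ev_lin_ne (v.2 : ℝ) n e1)).and (ev_lin_ne (v.2 : ℝ) (-n) e2)).exists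
      rcases h1 with h1 | h1
      · exact absurd h1 h2
      · exact absurd h1 h3

open Filter Topology in
lemma ev_le_of {x y k l : ℝ} (h : ∀ᶠ t in 𝓝[>] (0 : ℝ), x + t * k ≤ y + t * l) : x ≤ y := by
  by_contra h0
  obtain ⟨t, h1, h2⟩ := (h.and (ev_lin_lt l k (not_le.mp h0))).exists
  linarith

open Filter Topology in
lemma dirs_vert (g : ℕ) (c : ℤ → ℝ) (hc : Hyp g c) (X Y : ℝ) (d : ℤ) (hd : d ≠ 0) :
    (∀ᶠ t in 𝓝[>] (0 : ℝ), (X + t * ((0 : ℤ) : ℝ), Y + t * (d : ℝ)) ∈ Gam g c) ↔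
      (c 0 - c 1 ≤ X ∧ X ≤ 0) ∧ Kink g c X ∧ 
      ∀ᶠ t in 𝓝[>] (0 : ℝ), c (-1) - Ptilde g c X ≤ Y + t * d ∧ Y + t * d ≤ Ptilde g c X := by
  have hP := Ptilde_gt g c hc X
  have hpos : ∀ᶠ t in 𝓝[>] (0 : ℝ), 0 < t := self_mem_nhdsWithin
  have hd' : (d : ℝ) ≠ 0 := by exact_mod_cast hd
  have ne : ∀ z : ℝ, ∀ᶠ t in 𝓝[>] (0 : ℝ), Y + t * d ≠ z := by
    intro z
    by_cases hz : Y = z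
    · filter_upwards [hpos] with t ht h0
      have := mul_ne_zero ht.ne' hd'
      apply this; linarith
    · simpa using ev_lin_ne (d : ℝ) 0 hz
  simp only [Int.cast_zero, mul_zero, add_zero, mem_Gam g c hc]
  constructor
  · intro h
    refine ⟨?_, ?_, ?_⟩
    · obtain ⟨t, ht⟩ := h.exists
      exact ht.2
    · obtain ⟨t, ⟨h1, h2⟩, h3⟩ :=
        ((h.and (ne (Ptilde g c X))).and (ne (c (-1) - Ptilde g c X))).exists
      rcases h1.1 with h | h | h
      · exact absurd h h2
      · exact absurd h h3
      · exact h.2.2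
    · filter_upwards [h] with t ht
      rcases ht.1 with h | h | h
      · constructor <;> linarith
      · constructor <;> linarith
      · exact ⟨h.1.le, h.2.1.le⟩
  · rintro ⟨h1, h2, h3⟩
    filter_upwards [h3, ne (Ptilde g c X), ne (c (-1) - Ptilde g c X)] with t h4 h5 h6
    exact ⟨Or.inr (Or.inr ⟨lt_of_le_of_ne h4.1 (Ne.symm h6), lt_of_le_of_ne h4.2 h5, h2⟩), h1⟩

open Filter Topology in
lemma dirs_vert_up (g : ℕ) (c : ℤ → ℝ) (X Y : ℝ) :
    (∀ᶠ t in 𝓝[>] (0 : ℝ), c (-1) - Ptilde g c X ≤ Y + t * ((1 : ℤ) : ℝ) ∧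
      Y + t * ((1 : ℤ) : ℝ) ≤ Ptilde g c X) ↔ 
      c (-1) - Ptilde g c X ≤ Y ∧ Y < Ptilde g c X := by
  have hpos : ∀ᶠ t in 𝓝[>] (0 : ℝ), 0 < t := self_mem_nhdsWithin
  simp only [Int.cast_one, mul_one]
  constructor
  · intro h
    constructor
    · apply ev_le_of (k := 0) (l := 1)
      filter_upwards [h] with t ht
      linarith [ht.1]
    · obtain ⟨t, h1, h2⟩ := (h.and hpos).exists
      linarith [h1.2]
  · rintro ⟨h1, h2⟩
    filter_upwards [hpos, ev_lin_lt 1 0 h2] with t ht h3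
    constructor <;> linarith

open Filter Topology in
lemma dirs_vert_down (g : ℕ) (c : ℤ → ℝ) (X Y : ℝ) :
    (∀ᶠ t in 𝓝[>] (0 : ℝ), c (-1) - Ptilde g c X ≤ Y + t * ((-1 : ℤ) : ℝ) ∧
      Y + t * ((-1 : ℤ) : ℝ) ≤ Ptilde g c X) ↔ 
      c (-1) - Ptilde g c X < Y ∧ Y ≤ Ptilde g c X := by
  have hpos : ∀ᶠ t in 𝓝[>] (0 : ℝ), 0 < t := self_mem_nhdsWithin
  simp only [Int.cast_neg, Int.cast_one, mul_neg, mul_one]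
  constructor
  · intro h
    constructor
    · obtain ⟨t, h1, h2⟩ := (h.and hpos).exists
      linarith [h1.1]
    · apply ev_le_of (k := -1) (l := 0)
      filter_upwards [h] with t ht
      linarith [ht.2]
  · rintro ⟨h1, h2⟩
    filter_upwards [hpos, ev_lin_lt 0 (-1) h1] with t ht h3
    constructor <;> linarith

lemma unit_of_coprime {a b m : ℤ} (h : IsCoprime a b) (hb : b = a * m) : a = 1 ∨ a = -1 := by
  have : IsUnit a := h.isUnit_of_dvd' dvd_rfl ⟨m, hb⟩
  exact Int.isUnit_iff.mp this

open Filter Topology in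
/-- Full description of the outgoing directions. -/
lemma mem_localDirs (g : ℕ) (c : ℤ → ℝ) (hc : Hyp g c) (X Y : ℝ) :
    ∃ r l : ℤ, ∀ v : ℤ × ℤ, v ∈ localDirs (Gam g c) (X, Y) ↔
      (v = (0, 1) ∧ c 0 - c 1 ≤ X ∧ X ≤ 0 ∧ Kink g c X ∧
        c (-1) - Ptilde g c X ≤ Y ∧ Y < Ptilde g c X) ∨
      (v = (0, -1) ∧ c 0 - c 1 ≤ X ∧ X ≤ 0 ∧ Kink g c X ∧
        c (-1) - Ptilde g c X < Y ∧ Y ≤ Ptilde g c X) ∨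
      (v = (1, r) ∧ c 0 - c 1 ≤ X ∧ X < 0 ∧ (Y = Ptilde g c X ∨ Y = c (-1) - Ptilde g c X)) ∨
      (v = (-1, l) ∧ c 0 - c 1 < X ∧ X ≤ 0 ∧
        (Y = Ptilde g c X ∨ Y = c (-1) - Ptilde g c X)) := by
  classical
  have hP := Ptilde_gt g c hc X
  obtain ⟨mr, εr, hεr, hr⟩ := Ptilde_right g c X
  obtain ⟨ml, εl, hεl, hl⟩ := Ptilde_left g c X
  have hpos : ∀ᶠ t in 𝓝[>] (0 : ℝ), 0 < t := self_mem_nhdsWithin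
  have hr' : ∀ k : ℝ, 0 < k → ∀ᶠ t in 𝓝[>] (0 : ℝ),
      Ptilde g c (X + t * k) = Ptilde g c X + t * (k * mr) := by
    intro k hk
    filter_upwards [Ioo_mem_nhdsGT (div_pos hεr hk)] with t ht
    rw [hr (t * k) (mul_pos ht.1 hk).le ((lt_div_iff₀ hk).mp ht.2)]; ring
  have hl' : ∀ k : ℝ, k < 0 → ∀ᶠ t in 𝓝[>] (0 : ℝ),
      Ptilde g c (X + t * k) = Ptilde g c X + t * (-k * ml) := by
    intro k hk
    have hk' : 0 < -k := by linarith
    filter_upwards [Ioo_mem_nhdsGT (div_pos hεl hk')] with t ht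
    have := hl (t * -k) (mul_pos ht.1 hk').le ((lt_div_iff₀ hk').mp ht.2)
    rw [show X - t * -k = X + t * k by ring] at this
    rw [this]; ring
  refine ⟨if Y = Ptilde g c X then mr else -mr, if Y = Ptilde g c X then ml else -ml,
    fun v => ?_⟩
  rw [localDirs_iff]
  constructor
  · rintro ⟨hcop, hv⟩
    obtain ⟨v1, v2⟩ := v
    simp only at hcop hv
    rcases lt_trichotomy v1 0 with hneg | hz | hp
    · have hk : (v1 : ℝ) < 0 := by exact_mod_cast hneg
      have hd := dirs_nonvert g c hc X Y (v1, v2) _ hneg.ne hv (hl' _ hk)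
      have hX : c 0 - c 1 < X ∧ X ≤ 0 := by
        constructor
        · obtain ⟨t, h1, h2⟩ := (hv.and hpos).exists
          rw [mem_Gam g c hc] at h1
          nlinarith [h1.2.1]
        · apply ev_le_of (k := (v1 : ℝ)) (l := 0)
          filter_upwards [hv] with t h1
          rw [mem_Gam g c hc] at h1
          linarith [h1.2.2]
      right; right; right
      rcases hd with ⟨h1, h2⟩ | ⟨h1, h2⟩
      · have h2' : v2 = v1 * (-ml) := by
          simp only at h2
          have : (v2 : ℝ) = ((v1 * (-ml) : ℤ) : ℝ) := by push_cast; linarith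
          exact_mod_cast this
        have hv1 : v1 = -1 := by rcases unit_of_coprime hcop h2' with h | h <;> omega
        refine ⟨?_, hX.1, hX.2, Or.inl h1⟩
        rw [if_pos h1, h2', hv1]; simp
      · have h2' : v2 = v1 * ml := by
          simp only at h2
          have : (v2 : ℝ) = ((v1 * ml : ℤ) : ℝ) := by push_cast; linarith
          exact_mod_cast this
        have hv1 : v1 = -1 := by rcases unit_of_coprime hcop h2' with h | h <;> omega
        refine ⟨?_, hX.1, hX.2, Or.inr h1⟩
        rw [if_neg (by intro h0; linarith), h2', hv1]; simp
    · subst hz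
      have : v2 = 1 ∨ v2 = -1 := by
        rw [isCoprime_zero_left] at hcop
        exact Int.isUnit_iff.mp hcop
      rcases this with rfl | rfl
      · left
        rw [dirs_vert g c hc X Y 1 (by norm_num), dirs_vert_up] at hv
        exact ⟨rfl, hv.1.1, hv.1.2, hv.2.1, hv.2.2⟩
      · right; left
        rw [dirs_vert g c hc X Y (-1) (by norm_num), dirs_vert_down] at hv
        exact ⟨rfl, hv.1.1, hv.1.2, hv.2.1, hv.2.2⟩
    · have hk : (0 : ℝ) < v1 := by exact_mod_cast hp
      have hd := dirs_nonvert g c hc X Y (v1, v2) _ hp.ne' hv (hr' _ hk)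
      have hX : c 0 - c 1 ≤ X ∧ X < 0 := by
        constructor
        · apply ev_le_of (k := 0) (l := (v1 : ℝ))
          filter_upwards [hv] with t h1
          rw [mem_Gam g c hc] at h1
          linarith [h1.2.1]
        · obtain ⟨t, h1, h2⟩ := (hv.and hpos).exists
          rw [mem_Gam g c hc] at h1
          nlinarith [h1.2.2]
      right; right; left
      rcases hd with ⟨h1, h2⟩ | ⟨h1, h2⟩
      · have h2' : v2 = v1 * mr := by
          simp only at h2
          exact_mod_cast h2
        have hv1 : v1 = 1 := by rcases unit_of_coprime hcop h2' with h | h <;> omega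
        refine ⟨?_, hX.1, hX.2, Or.inl h1⟩
        rw [if_pos h1, h2', hv1]; simp
      · have h2' : v2 = v1 * (-mr) := by
          simp only at h2
          have : (v2 : ℝ) = ((v1 * (-mr) : ℤ) : ℝ) := by push_cast; linarith
          exact_mod_cast this
        have hv1 : v1 = 1 := by rcases unit_of_coprime hcop h2' with h | h <;> omega
        refine ⟨?_, hX.1, hX.2, Or.inr h1⟩
        rw [if_neg (by intro h0; linarith), h2', hv1]; simp
  · rintro (⟨rfl, h1, h2, h3, h4⟩ | ⟨rfl, h1, h2, h3, h4⟩ | ⟨rfl, h1, h2, h3⟩ | ⟨rfl, h1, h2, h3⟩)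
    · refine ⟨isCoprime_one_right, ?_⟩
      rw [dirs_vert g c hc X Y 1 (by norm_num), dirs_vert_up]
      exact ⟨⟨h1, h2⟩, h3, h4⟩
    · refine ⟨isCoprime_one_right.neg_right, ?_⟩
      rw [dirs_vert g c hc X Y (-1) (by norm_num), dirs_vert_down]
      exact ⟨⟨h1, h2⟩, h3, h4⟩
    · refine ⟨isCoprime_one_left, ?_⟩
      filter_upwards [hr' 1 one_pos, ev_lin_lt 1 0 h2, hpos] with t ht1 ht2 ht3
      rw [mem_Gam g c hc]
      simp only [Int.cast_one]
      rw [ht1]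
      refine ⟨?_, by linarith, by linarith⟩
      split_ifs with h
      · left; rw [h]; ring
      · right; left
        rw [h3.resolve_left h]; push_cast; ring
    · refine ⟨isCoprime_one_left.neg_left, ?_⟩
      filter_upwards [hl' (-1) (by norm_num), ev_lin_lt 0 (-1) h1, hpos] with t ht1 ht2 ht3
      rw [mem_Gam g c hc]
      simp only [Int.cast_neg, Int.cast_one]
      rw [ht1]
      refine ⟨?_, by linarith, by linarith⟩
      split_ifs with h
      · left; rw [h]; ring
      · right; left
        rw [h3.resolve_left h]; push_cast; ring

open Filter Topology in
lemma hasSlope_iff (S : Set (ℝ × ℝ)) (f : ℝ × ℝ → ℝ) (X Y : ℝ) (v : ℤ × ℤ) (s : ℤ) :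
    HasSlope S f (X, Y) v s ↔ ∀ᶠ t in 𝓝[>] (0 : ℝ), (X + t * v.1, Y + t * v.2) ∈ S →
      f (X + t * v.1, Y + t * v.2) = f (X, Y) + s * t := by
  rw [← ev_iff]
  unfold HasSlope
  simp only [add_vr]
  constructor
  · rintro ⟨ε, hε, h⟩
    exact ⟨ε, hε, fun t h0 h1 => h t h0.le h1⟩
  · rintro ⟨ε, hε, h⟩
    refine ⟨ε, hε, fun t h0 h1 => ?_⟩
    rcases h0.eq_or_lt with rfl | h0
    · intro _; simp
    · exact h t h0 h1

open Filter Topology in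
lemma slope_eq {S : Set (ℝ × ℝ)} {f : ℝ × ℝ → ℝ} {P : ℝ × ℝ} {v : ℤ × ℤ} {s : ℤ}
    (hv : v ∈ localDirs S P) (h : HasSlope S f P v s) : slope S f P v = s := by
  have hex : ∃ s : ℤ, HasSlope S f P v s := ⟨s, h⟩
  unfold slope
  rw [dif_pos hex]
  have h' := hex.choose_spec
  set s' := hex.choose
  obtain ⟨X, Y⟩ := P
  rw [hasSlope_iff] at h h'
  rw [localDirs_iff] at hv
  have hpos : ∀ᶠ t in 𝓝[>] (0 : ℝ), 0 < t := self_mem_nhdsWithin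
  obtain ⟨t, ⟨⟨h1, h2⟩, h3⟩, h4⟩ := (((h.and h').and hv.2).and hpos).exists
  have e := (h1 h3).symm.trans (h2 h3)
  have : (s : ℝ) = s' := mul_right_cancel₀ h4.ne' (by linarith)
  exact_mod_cast this.symm

lemma HasSlope.add {S : Set (ℝ × ℝ)} {f k : ℝ × ℝ → ℝ} {P : ℝ × ℝ} {v : ℤ × ℤ} {s s' : ℤ}
    (h : HasSlope S f P v s) (h' : HasSlope S k P v s') :
    HasSlope S (fun Q => f Q + k Q) P v (s + s') := by
  obtain ⟨X, Y⟩ := P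
  rw [hasSlope_iff] at h h' ⊢
  filter_upwards [h, h'] with t h1 h2 hS
  rw [h1 hS, h2 hS]; push_cast; ring

lemma localDirs_finite (g : ℕ) (c : ℤ → ℝ) (hc : Hyp g c) (P : ℝ × ℝ) :
    (localDirs (Gam g c) P).Finite := by
  obtain ⟨X, Y⟩ := P
  obtain ⟨r, l, h⟩ := mem_localDirs g c hc X Y
  apply Set.Finite.subset (Set.toFinite ({(0, 1), (0, -1), (1, r), (-1, l)} : Set (ℤ × ℤ)))
  intro v hv
  rw [h] at hv
  simp only [Set.mem_insert_iff, Set.mem_singleton_iff]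
  tauto

lemma localDirs_mem (g : ℕ) (c : ℤ → ℝ) (hc : Hyp g c) {P : ℝ × ℝ} {v : ℤ × ℤ}
    (hv : v ∈ localDirs (Gam g c) P) : P ∈ Gam g c := by
  obtain ⟨X, Y⟩ := P
  obtain ⟨r, l, h⟩ := mem_localDirs g c hc X Y
  rw [h] at hv
  rw [mem_Gam g c hc]
  rcases hv with h | h | h | h
  · refine ⟨?_, h.2.1, h.2.2.1⟩
    rcases h.2.2.2.2.1.eq_or_lt with h' | h'
    · right; left; exact h'.symm
    · right; right; exact ⟨h', h.2.2.2.2.2, h.2.2.2.1⟩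
  · refine ⟨?_, h.2.1, h.2.2.1⟩
    rcases h.2.2.2.2.2.eq_or_lt with h' | h'
    · left; exact h'
    · right; right; exact ⟨h.2.2.2.2.1, h', h.2.2.2.1⟩
  · exact ⟨h.2.2.2.imp_right Or.inl, h.2.1, h.2.2.1.le⟩
  · exact ⟨h.2.2.2.imp_right Or.inl, h.2.1.le, h.2.2.1⟩

lemma ord_add (g : ℕ) (c : ℤ → ℝ) (hc : Hyp g c) {f k : ℝ × ℝ → ℝ}
    (hf : IsRationalFn (Gam g c) f) (hk : IsRationalFn (Gam g c) k) (P : ℝ × ℝ) :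
    ord (Gam g c) (fun Q => f Q + k Q) P = ord (Gam g c) f P + ord (Gam g c) k P := by
  unfold ord
  rw [← finsum_mem_add_distrib (localDirs_finite g c hc P)]
  apply finsum_mem_congr rfl
  intro v hv
  have hP := localDirs_mem g c hc hv
  obtain ⟨s, hs⟩ := hf.slope_int P hP v hv
  obtain ⟨s', hs'⟩ := hk.slope_int P hP v hv
  rw [slope_eq hv hs, slope_eq hv hs', slope_eq hv (hs.add hs')]

lemma IsRationalFn.add {S : Set (ℝ × ℝ)} {f k : ℝ × ℝ → ℝ}
    (hf : IsRationalFn S f) (hk : IsRationalFn S k) : IsRationalFn S (fun Q => f Q + k Q) where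
  cont := hf.cont.add hk.cont
  slope_int := by
    intro P hP v hv
    obtain ⟨s, hs⟩ := hf.slope_int P hP v hv
    obtain ⟨s', hs'⟩ := hk.slope_int P hP v hv
    exact ⟨_, hs.add hs'⟩

lemma hasSlope_zero (S : Set (ℝ × ℝ)) (P : ℝ × ℝ) (v : ℤ × ℤ) :
    HasSlope S (fun _ => (0 : ℝ)) P v 0 := ⟨1, one_pos, fun t _ _ _ => by simp⟩

lemma exists_sum (g : ℕ) (c : ℤ → ℝ) (hc : Hyp g c) {ι : Type*} (s : Finset ι) (D : ι → Div)
    (hD : ∀ i ∈ s, IsPrincipal (Gam g c) (D i)) : IsPrincipal (Gam g c) (∑ i ∈ s, D i) := by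
  classical
  induction s using Finset.induction_on with
  | empty =>
    refine ⟨fun _ => 0, ⟨continuousOn_const, fun P _ v _ => ⟨0, hasSlope_zero _ _ _⟩⟩, fun P => ?_⟩
    unfold ord
    rw [finsum_mem_congr (g := fun _ => (0 : ℤ)) rfl
      (fun v hv => slope_eq hv (hasSlope_zero _ _ _))]
    simp
  | insert a s ha ih =>
    obtain ⟨f, hf, hf'⟩ := ih (fun i hi => hD i (Finset.mem_insert_of_mem hi))
    obtain ⟨k, hk, hk'⟩ := hD a (Finset.mem_insert_self _ _)
    refine ⟨_, hk.add hf, fun P => ?_⟩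
    rw [ord_add g c hc hk hf, Finset.sum_insert ha, Finsupp.add_apply, hf', hk']

open Classical in
lemma ord_formula (g : ℕ) (c : ℤ → ℝ) (hc : Hyp g c) (X Y : ℝ) (f : ℝ × ℝ → ℝ)
    (s1 s2 s3 s4 : ℤ)
    (h1 : HasSlope (Gam g c) f (X, Y) (0, 1) s1)
    (h2 : HasSlope (Gam g c) f (X, Y) (0, -1) s2)
    (h3 : (Y = Ptilde g c X ∨ Y = c (-1) - Ptilde g c X) →
      ∀ r, HasSlope (Gam g c) f (X, Y) (1, r) s3)
    (h4 : (Y = Ptilde g c X ∨ Y = c (-1) - Ptilde g c X) →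
      ∀ l, HasSlope (Gam g c) f (X, Y) (-1, l) s4) :
    (∀ v ∈ localDirs (Gam g c) (X, Y), ∃ s, HasSlope (Gam g c) f (X, Y) v s) ∧
    ord (Gam g c) f (X, Y) =
      (if c 0 - c 1 ≤ X ∧ X ≤ 0 ∧ Kink g c X ∧
        c (-1) - Ptilde g c X ≤ Y ∧ Y < Ptilde g c X then s1 else 0) +
      (if c 0 - c 1 ≤ X ∧ X ≤ 0 ∧ Kink g c X ∧
        c (-1) - Ptilde g c X < Y ∧ Y ≤ Ptilde g c X then s2 else 0) +
      (if c 0 - c 1 ≤ X ∧ X < 0 ∧ (Y = Ptilde g c X ∨ Y = c (-1) - Ptilde g c X)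
        then s3 else 0) +
      (if c 0 - c 1 < X ∧ X ≤ 0 ∧ (Y = Ptilde g c X ∨ Y = c (-1) - Ptilde g c X)
        then s4 else 0) := by
  obtain ⟨r, l, h⟩ := mem_localDirs g c hc X Y
  constructor
  · intro v hv
    rcases (h v).mp hv with h' | h' | h' | h'
    · rw [h'.1]; exact ⟨_, h1⟩
    · rw [h'.1]; exact ⟨_, h2⟩
    · rw [h'.1]; exact ⟨_, h3 h'.2.2.2 r⟩
    · rw [h'.1]; exact ⟨_, h4 h'.2.2.2 l⟩
  · unfold ord
    have hset : localDirs (Gam g c) (X, Y) =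
        (({(0, 1), (0, -1), (1, r), (-1, l)} : Finset (ℤ × ℤ)).filter
          (fun v => v ∈ localDirs (Gam g c) (X, Y)) : Set (ℤ × ℤ)) := by
      ext v
      simp only [Finset.coe_filter, Finset.mem_insert, Finset.mem_singleton]
      constructor
      · intro hv
        refine ⟨?_, hv⟩
        rcases (h v).mp hv with h' | h' | h' | h'
        · simp [h'.1]
        · simp [h'.1]
        · simp [h'.1]
        · simp [h'.1]
      · exact fun hv => hv.2
    have e1 : ((0, 1) : ℤ × ℤ) ∈ localDirs (Gam g c) (X, Y) ↔ (c 0 - c 1 ≤ X ∧ X ≤ 0 ∧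
        Kink g c X ∧ c (-1) - Ptilde g c X ≤ Y ∧ Y < Ptilde g c X) := by rw [h]; simp
    have e2 : ((0, -1) : ℤ × ℤ) ∈ localDirs (Gam g c) (X, Y) ↔ (c 0 - c 1 ≤ X ∧ X ≤ 0 ∧
        Kink g c X ∧ c (-1) - Ptilde g c X < Y ∧ Y ≤ Ptilde g c X) := by rw [h]; simp
    have e3 : ((1, r) : ℤ × ℤ) ∈ localDirs (Gam g c) (X, Y) ↔ (c 0 - c 1 ≤ X ∧ X < 0 ∧
        (Y = Ptilde g c X ∨ Y = c (-1) - Ptilde g c X)) := by rw [h]; simp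
    have e4 : ((-1, l) : ℤ × ℤ) ∈ localDirs (Gam g c) (X, Y) ↔ (c 0 - c 1 < X ∧ X ≤ 0 ∧
        (Y = Ptilde g c X ∨ Y = c (-1) - Ptilde g c X)) := by rw [h]; simp
    rw [hset, finsum_mem_coe_finset, Finset.sum_filter, Finset.sum_insert (by simp),
      Finset.sum_insert (by simp), Finset.sum_insert (by simp), Finset.sum_singleton]
    have k1 : (if ((0, 1) : ℤ × ℤ) ∈ localDirs (Gam g c) (X, Y) then
        slope (Gam g c) f (X, Y) (0, 1) else 0) =
        if ((0, 1) : ℤ × ℤ) ∈ localDirs (Gam g c) (X, Y) then s1 else 0 := by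
      split_ifs with hv
      · exact slope_eq hv h1
      · rfl
    have k2 : (if ((0, -1) : ℤ × ℤ) ∈ localDirs (Gam g c) (X, Y) then
        slope (Gam g c) f (X, Y) (0, -1) else 0) =
        if ((0, -1) : ℤ × ℤ) ∈ localDirs (Gam g c) (X, Y) then s2 else 0 := by
      split_ifs with hv
      · exact slope_eq hv h2
      · rfl
    have k3 : (if ((1, r) : ℤ × ℤ) ∈ localDirs (Gam g c) (X, Y) then
        slope (Gam g c) f (X, Y) (1, r) else 0) =
        if ((1, r) : ℤ × ℤ) ∈ localDirs (Gam g c) (X, Y) then s3 else 0 := by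
      split_ifs with hv
      · exact slope_eq hv (h3 (e3.mp hv).2.2 r)
      · rfl
    have k4 : (if ((-1, l) : ℤ × ℤ) ∈ localDirs (Gam g c) (X, Y) then
        slope (Gam g c) f (X, Y) (-1, l) else 0) =
        if ((-1, l) : ℤ × ℤ) ∈ localDirs (Gam g c) (X, Y) then s4 else 0 := by
      split_ifs with hv
      · exact slope_eq hv (h4 (e4.mp hv).2.2 l)
      · rfl
    rw [k1, k2, k3, k4]
    simp only [e1, e2, e3, e4]
    ring

open Filter Topology in
lemma ev_max (x y : ℝ) : ∀ᶠ t in 𝓝[>] (0 : ℝ),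
    max (x + t) y = max x y + ((if y ≤ x then 1 else 0 : ℤ) : ℝ) * t := by
  have hpos : ∀ᶠ t in 𝓝[>] (0 : ℝ), 0 < t := self_mem_nhdsWithin
  split_ifs with h
  · filter_upwards [hpos] with t ht
    rw [max_eq_left h, max_eq_left (by linarith)]; simp
  · filter_upwards [ev_lin_lt 1 0 (not_le.mp h)] with t ht
    rw [max_eq_right (not_le.mp h).le, max_eq_right (by linarith)]; simp

open Filter Topology in
lemma ev_max_neg (x y : ℝ) : ∀ᶠ t in 𝓝[>] (0 : ℝ),
    max (x - t) y = max x y + ((if y < x then -1 else 0 : ℤ) : ℝ) * t := by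
  have hpos : ∀ᶠ t in 𝓝[>] (0 : ℝ), 0 < t := self_mem_nhdsWithin
  split_ifs with h
  · filter_upwards [ev_lin_lt 0 (-1) h] with t ht
    rw [max_eq_left h.le, max_eq_left (by linarith)]; simp; ring
  · filter_upwards [hpos] with t ht
    rw [max_eq_right (not_lt.mp h), max_eq_right (by linarith)]; simp

/-- The function with divisor `P + P′ - V_0 - V_0′`, `P = (a, b)`. -/
noncomputable def hfun (g : ℕ) (c : ℤ → ℝ) (a b : ℝ) (Q : ℝ × ℝ) : ℝ :=
  open scoped Classical in
  max Q.1 a + if Q.1 = a then max Q.2 b + max (c (-1) - b - Q.2) 0 - Ptilde g c a else 0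

lemma hfun_vertex (g : ℕ) (c : ℤ → ℝ) {a b X Y : ℝ} (hb : c (-1) ≤ 2 * b)
    (hb' : b ≤ Ptilde g c a) (hY : Y = Ptilde g c X ∨ Y = c (-1) - Ptilde g c X) :
    hfun g c a b (X, Y) = max X a := by
  unfold hfun
  simp only
  split_ifs with h
  · subst h
    rw [max_self]
    rcases hY with rfl | rfl
    · rw [max_eq_left hb', max_eq_right (by linarith)]; ring
    · rw [max_eq_right (a := c (-1) - _) (by linarith), max_eq_left (by linarith)]; ring
  · simp

lemma aux_min {C b p W : ℝ} (hb : C ≤ 2 * b) :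
    max W b + max (C - b - W) 0 - p = - min (min (p - W) (W - (C - p))) (p - b) := by
  simp only [max_def, min_def]
  split_ifs <;> linarith

open Filter Topology in
lemma hfun_cont (g : ℕ) (c : ℤ → ℝ) (hc : Hyp g c) {a b : ℝ} (hb : c (-1) ≤ 2 * b)
    (hb' : b ≤ Ptilde g c a) : ContinuousOn (hfun g c a b) (Gam g c) := by
  rintro ⟨X, Y⟩ hP
  by_cases hX : X = a
  · subst hX
    obtain ⟨ε, hε, hk⟩ := not_kink_near g c X
    have hcont := Ptilde_cont g c
    have : hfun g c X b =ᶠ[𝓝[Gam g c] (X, Y)] fun Q => max Q.1 X -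
        min (min (Ptilde g c Q.1 - Q.2) (Q.2 - (c (-1) - Ptilde g c Q.1)))
          (Ptilde g c X - b) := by
      have o : IsOpen {Q : ℝ × ℝ | |Q.1 - X| < ε} := isOpen_lt (by fun_prop) continuous_const
      filter_upwards [self_mem_nhdsWithin,
        nhdsWithin_le_nhds (o.mem_nhds (show (X, Y) ∈ {Q : ℝ × ℝ | |Q.1 - X| < ε} by
          simpa using hε))] with Q hQ hQ'
      obtain ⟨Z, W⟩ := Q
      have hQ' : |Z - X| < ε := hQ'
      have hPZ := Ptilde_gt g c hc Z
      rw [mem_Gam g c hc] at hQ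
      simp only
      by_cases hZ : Z = X
      · subst hZ
        unfold hfun
        simp only [if_true]
        rw [aux_min hb]; ring
      · have hv : W = Ptilde g c Z ∨ W = c (-1) - Ptilde g c Z := by
          rcases hQ.1 with h | h | h
          · exact Or.inl h
          · exact Or.inr h
          · exact absurd h.2.2 (hk Z hQ' hZ)
        rw [hfun_vertex g c hb hb' hv]
        have : min (min (Ptilde g c Z - W) (W - (c (-1) - Ptilde g c Z)))
          (Ptilde g c X - b) = 0 := by
          rcases hv with rfl | rfl
          · rw [min_eq_left (a := Ptilde g c Z - _) (by linarith), min_eq_left (by linarith)]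
            ring
          · rw [min_eq_right (a := Ptilde g c Z - _) (by linarith), min_eq_left (by linarith)]
            ring
        rw [this]; ring
    refine ContinuousWithinAt.congr_of_eventuallyEq ?_ this (this.self_of_nhdsWithin hP)
    apply Continuous.continuousWithinAt
    fun_prop
  · have : hfun g c a b =ᶠ[𝓝 (X, Y)] fun Q => max Q.1 a := by
      have o : IsOpen {Q : ℝ × ℝ | Q.1 ≠ a} := isOpen_ne_fun continuous_fst continuous_const
      filter_upwards [o.mem_nhds (show (X, Y) ∈ {Q : ℝ × ℝ | Q.1 ≠ a} from hX)] with Q hQ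
      have hQ : Q.1 ≠ a := hQ
      unfold hfun
      rw [if_neg hQ]; ring
    apply ContinuousAt.continuousWithinAt
    refine ContinuousAt.congr_of_eventuallyEq ?_ this
    fun_prop

open Filter Topology Classical in
lemma hfun_up (g : ℕ) (c : ℤ → ℝ) (a b X Y : ℝ) :
    HasSlope (Gam g c) (hfun g c a b) (X, Y) (0, 1) (if X = a then
      (if b ≤ Y then 1 else 0) + (if 0 < c (-1) - b - Y then -1 else 0) else 0) := by
  rw [hasSlope_iff]
  filter_upwards [ev_max Y b, ev_max_neg (c (-1) - b - Y) 0] with t h1 h2 _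
  simp only [hfun, Int.cast_zero, mul_zero, add_zero, Int.cast_one, mul_one]
  by_cases h : X = a
  · simp only [h, if_true]
    rw [h1, show c (-1) - b - (Y + t) = c (-1) - b - Y - t by ring, h2]
    push_cast; ring
  · simp [h]

open Filter Topology Classical in
lemma hfun_down (g : ℕ) (c : ℤ → ℝ) (a b X Y : ℝ) :
    HasSlope (Gam g c) (hfun g c a b) (X, Y) (0, -1) (if X = a then
      (if b < Y then -1 else 0) + (if 0 ≤ c (-1) - b - Y then 1 else 0) else 0) := by
  rw [hasSlope_iff]
  filter_upwards [ev_max_neg Y b, ev_max (c (-1) - b - Y) 0] with t h1 h2 _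
  simp only [hfun, Int.cast_zero, mul_zero, add_zero, Int.cast_neg, Int.cast_one, mul_neg, mul_one]
  by_cases h : X = a
  · simp only [h, if_true]
    rw [← sub_eq_add_neg, h1, show c (-1) - b - (Y - t) = c (-1) - b - Y + t by ring, h2]
    push_cast; ring
  · simp [h]

open Filter Topology Classical in
lemma hfun_side (g : ℕ) (c : ℤ → ℝ) (hc : Hyp g c) {a b X Y : ℝ} (hb : c (-1) ≤ 2 * b)
    (hb' : b ≤ Ptilde g c a) (hY : Y = Ptilde g c X ∨ Y = c (-1) - Ptilde g c X) (v : ℤ × ℤ)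
    (hv : v.1 ≠ 0) (s : ℤ)
    (hs : ∀ᶠ t in 𝓝[>] (0 : ℝ), max (X + t * v.1) a = max X a + s * t) :
    HasSlope (Gam g c) (hfun g c a b) (X, Y) v s := by
  rw [hasSlope_iff]
  have hv' : (v.1 : ℝ) ≠ 0 := by exact_mod_cast hv
  filter_upwards [hs, ev_not_kink g c X hv'] with t h1 h2 h3
  rw [hfun_vertex g c hb hb' hY, ← h1, hfun_vertex g c hb hb']
  rw [mem_Gam g c hc] at h3
  rcases h3.1 with h | h | h
  · exact Or.inl h
  · exact Or.inr h
  · exact absurd h.2.2 h2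

set_option maxHeartbeats 4000000 in
open Classical in
lemma pair_principal (g : ℕ) (c : ℤ → ℝ) (hg2 : 2 ≤ g) (hc : Hyp g c) (a b : ℝ)
    (hab : (a, b) ∈ Gam g c) (hb : c (-1) ≤ 2 * b) :
    IsPrincipal (Gam g c)
      ((Finsupp.single (a, b) (1 : ℤ) + Finsupp.single (a, c (-1) - b) (1 : ℤ)) -
        (Finsupp.single (0, 0) (1 : ℤ) + Finsupp.single (0, c (-1)) (1 : ℤ))) := by
  have hP := Ptilde_gt g c hc
  have hP0 := Ptilde_zero g c hg2 hc
  have hab' := (mem_Gam g c hc a b).mp hab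
  have hb' : b ≤ Ptilde g c a := by
    have := hP a
    rcases hab'.1 with h | h | h <;> linarith
  have key := fun X Y => ord_formula g c hc X Y (hfun g c a b) _ _
    (if a ≤ X then 1 else 0) (if a < X then -1 else 0)
    (hfun_up g c a b X Y) (hfun_down g c a b X Y)
    (fun hY r => hfun_side g c hc hb hb' hY (1, r) (by norm_num) _ (by
      filter_upwards [ev_max X a] with t ht
      simpa using ht))
    (fun hY l => hfun_side g c hc hb hb' hY (-1, l) (by norm_num) _ (by
      filter_upwards [ev_max_neg X a] with t ht
      simpa [sub_eq_add_neg] using ht))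
  refine ⟨hfun g c a b, ⟨hfun_cont g c hc hb hb', ?_⟩, ?_⟩
  · rintro ⟨X, Y⟩ _ v hv
    exact (key X Y).1 v hv
  · rintro ⟨X, Y⟩
    rw [(key X Y).2]
    have hX := hP X
    obtain ⟨hab1, hab2, hab3⟩ := hab'
    have hnk : ¬ Kink g c a → b = Ptilde g c a := by
      intro h
      rcases hab1 with h1 | h1 | h1
      · exact h1
      · have := hP a; linarith
      · exact absurd h1.2.2 h
    simp only [Finsupp.coe_sub, Finsupp.coe_add, Pi.sub_apply, Pi.add_apply,
      Finsupp.single_apply, Prod.mk.injEq]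
    have hXp : X = a → Ptilde g c X = Ptilde g c a := fun h => by rw [h]
    have hX0 : X = 0 → Ptilde g c X = 0 := fun h => by rw [h, hP0]
    have hXk : X = a → (Kink g c X ↔ Kink g c a) := fun h => by rw [h]
    generalize Ptilde g c X = p at *
    generalize Ptilde g c a = q at *
    generalize Kink g c X = KX at *
    generalize Kink g c a = Ka at *
    clear key hP hP0 hab
    generalize c (-1) = C at *
    generalize c 0 - c 1 = x0 at *
    clear hc
    rcases lt_trichotomy X a with h1 | h1 | h1
    · have h2 : X < 0 := by linarith
      simp [h1.ne, h1.ne', h2.ne', not_le.mpr h1, not_lt.mpr h1.le]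
    · subst h1
      have hpq := hXp rfl
      subst hpq
      have hk : KX ↔ Ka := hXk rfl
      simp only [hk, hab2, hab3, true_and, if_true, le_refl, lt_irrefl, if_false, ite_self,
        add_zero]
      clear hXp hXk hk
      have e0 : X = 0 ↔ ¬ X < 0 := by
        constructor
        · intro h; linarith
        · intro h; linarith
      have hbY : C - b = Y ↔ b = C - Y := by constructor <;> intro h <;> linarith
      by_cases hK : Ka
      · simp only [hK, true_and]
        rcases lt_or_ge Y (C - p) with y1 | y1
        · have n1 : ¬ b = Y := by intro h; linarith
          have n2 : ¬ C - b = Y := by intro h; linarith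
          have n3 : ¬ (0 = X ∧ 0 = Y) := by rintro ⟨h, h'⟩; linarith [hX0 h.symm]
          have n4 : ¬ (0 = X ∧ C = Y) := by rintro ⟨h, h'⟩; linarith [hX0 h.symm]
          have n5 : ¬ Y = p := by intro h; linarith
          simp [n1, n2, n3, n4, n5, not_le.mpr y1, y1.ne, y1.le]
        · rcases lt_or_ge p Y with y2 | y2
          · have n1 : ¬ b = Y := by intro h; linarith
            have n2 : ¬ C - b = Y := by intro h; linarith
            have n3 : ¬ (0 = X ∧ 0 = Y) := by rintro ⟨h, h'⟩; linarith [hX0 h.symm]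
            have n4 : ¬ (0 = X ∧ C = Y) := by rintro ⟨h, h'⟩; linarith [hX0 h.symm]
            have n5 : ¬ Y = C - p := by intro h; linarith
            simp [n1, n2, n3, n4, n5, not_le.mpr y2, y2.ne', y2.le]
          · rcases lt_or_ge X 0 with x | x
            · have x' : ¬ 0 = X := x.ne'
              simp only [x, x', y1, y2, true_and, false_and, if_false]
              clear hX0 e0 hnk
              split_ifs <;> grind
            · have x' : 0 = X := by linarith
              have p0 := hX0 x'.symm
              subst p0
              simp only [← x', y1, y2, true_and, lt_irrefl, false_and, if_false]
              clear hX0 e0 hnk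
              split_ifs <;> grind
      · have hbp := hnk hK
        subst hbp
        simp only [hK, false_and, if_false]
        rcases lt_or_ge X 0 with x | x
        · have x' : ¬ 0 = X := x.ne'
          simp only [x, x', true_and, false_and, if_false]
          clear hX0 e0 hnk
          split_ifs <;> grind
        · have x' : 0 = X := by linarith
          have p0 := hX0 x'.symm
          subst p0
          simp only [← x', true_and, lt_irrefl, false_and, if_false]
          clear hX0 e0 hnk
          split_ifs <;> grind
    · have h2 : x0 < X := by linarith
      simp only [h1.ne, h1.ne', h1, h1.le, h2, h2.le, if_true, if_false, false_and, true_and,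
        ite_self]
      rcases lt_trichotomy X 0 with x | x | x
      · simp only [x, x.le, x.ne', true_and, false_and, if_false]
        split_ifs <;> simp
      · have p0 := hX0 x
        subst p0
        simp only [x, le_refl, lt_irrefl, true_and, false_and, if_false]
        split_ifs <;> grind
      · simp [x.ne, not_lt.mpr x.le, not_le.mpr x]

lemma pair_principal' (g : ℕ) (c : ℤ → ℝ) (hg2 : 2 ≤ g) (hc : Hyp g c) (Q : ℝ × ℝ)
    (hQ : Q ∈ Gam g c) :
    IsPrincipal (Gam g c)
      ((Finsupp.single Q (1 : ℤ) + Finsupp.single (conj c Q) (1 : ℤ)) -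
        (Finsupp.single (0, 0) (1 : ℤ) + Finsupp.single (0, c (-1)) (1 : ℤ))) := by
  obtain ⟨a, b⟩ := Q
  rcases le_total (c (-1)) (2 * b) with hb | hb
  · exact pair_principal g c hg2 hc a b hQ hb
  · have hQ' : (a, c (-1) - b) ∈ Gam g c := by
      rw [mem_Gam g c hc] at hQ ⊢
      refine ⟨?_, hQ.2⟩
      rcases hQ.1 with h | h | h
      · right; left; rw [h]
      · left; rw [h]; ring
      · right; right
        exact ⟨by linarith [h.2.1], by linarith [h.1], h.2.2⟩
    have := pair_principal g c hg2 hc a (c (-1) - b) hQ' (by linarith)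
    rw [sub_sub_cancel, add_comm (Finsupp.single (a, c (-1) - b) (1 : ℤ))] at this
    exact this

end TropicalHyperelliptic

/-- Let `g` be even, `Γ̄` the tropical hyperelliptic curve of genus `g`, `Γ` its
bounded part, and `D* = (g/2)(V_0 + V_0′)`.  For any points
`P_1, …, P_{g/2}` on `Γ` with conjugates `P_1′, …, P_{g/2}′` there is a rational
function `h` on `Γ` with
`(h) = P_1 + ⋯ + P_{g/2} + P_1′ + ⋯ + P_{g/2}′ − D*`; equivalently,
`(P_1 ⋯ P_{g/2} P_1′ ⋯ P_{g/2}′) = φ̄(P_1 + ⋯ + P_{g/2}′) = 0` in `J(Γ)`. -/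
theorem conj_pairs_sum_eq_zero (g : ℕ) (c : ℤ → ℝ) (hg : Even g) (hg2 : 2 ≤ g)
    (hc : Hyp g c) (Pt : Fin (g / 2) → ℝ × ℝ) (hPt : ∀ i, Pt i ∈ Gam g c) :
    ∃ h : (ℝ × ℝ) → ℝ, IsRationalFn (Gam g c) h ∧
      ∀ P : ℝ × ℝ,
        ((∑ i : Fin (g / 2),
            (Finsupp.single (Pt i) (1 : ℤ) + Finsupp.single (conj c (Pt i)) (1 : ℤ)))
          - DstarEven g c) P = ord (Gam g c) h P := by
  have hV0 : V g c 0 = (0, 0) := by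
    simp [V, hc.1, hc.2.1]
  have hV0' : conj c (V g c 0) = (0, c (-1)) := by
    rw [hV0]; simp [conj]
  have hpair : ∀ i : Fin (g / 2), IsPrincipal (Gam g c)
      ((Finsupp.single (Pt i) (1 : ℤ) + Finsupp.single (conj c (Pt i)) (1 : ℤ)) -
        (Finsupp.single (V g c 0) (1 : ℤ) + Finsupp.single (conj c (V g c 0)) (1 : ℤ))) := by
    intro i
    rw [hV0', hV0]
    exact pair_principal' g c hg2 hc (Pt i) (hPt i)
  obtain ⟨h, hh, hD⟩ := exists_sum g c hc Finset.univ _ (fun i _ => hpair i)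
  refine ⟨h, hh, fun P => ?_⟩
  rw [← hD P]
  congr 1
  rw [Finset.sum_sub_distrib]
  unfold DstarEven
  simp
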